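/- Let G' be the graph obtained from the cycle C_4 on vertices x_{11}, x_{21}, x_{31}, x_{41} by attaching, at each vertex x_{i1}, a path on three vertices x_{i1}, x_{i2}, x_{i3} (with edges {x_{i1}, x_{i2}} and {x_{i2}, x_{i3}}), attached at the endpoint x_{i1}. Then G' is not vertex decomposable. -/

import Mathlib

variable {V : Type*} [DecidableEq V]

/-- `S` is an independent set of the induced subgraph of `G` on the vertex set `A`. -/
def IsIndepIn (G : SimpleGraph V) (A S : Finset V) : Prop :=
  S ⊆ A ∧ ∀ u ∈ S, ∀ v ∈ S, ¬G.Adj u v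

/-- `S` is a maximal independent set of the induced subgraph of `G` on the vertex set `A`. -/
def IsMaxIndepIn (G : SimpleGraph V) (A S : Finset V) : Prop :=
  IsIndepIn G A S ∧ ∀ T, IsIndepIn G A T → S ⊆ T → S = T

/-- The induced subgraph of `G` on `A` is unmixed: all maximal independent sets
have the same cardinality. -/
def UnmixedOn (G : SimpleGraph V) (A : Finset V) : Prop :=
  ∀ S T, IsMaxIndepIn G A S → IsMaxIndepIn G A T → S.card = T.card

open scoped Classical in
/-- The vertex set `A \ N_G[x]`. -/
noncomputable def delClosedNbhd (G : SimpleGraph V) (A : Finset V) (x : V) : Finset V :=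
  A.filter fun y => y ≠ x ∧ ¬G.Adj x y

/-- The induced subgraph of `G` on `A` is vertex decomposable. -/
inductive VertexDecomposableOn (G : SimpleGraph V) : Finset V → Prop
  | edgeless (A : Finset V) (h : ∀ u ∈ A, ∀ v ∈ A, ¬G.Adj u v) : VertexDecomposableOn G A
  | shed (A : Finset V) (x : V) (hx : x ∈ A)
      (hlink : VertexDecomposableOn G (delClosedNbhd G A x))
      (hdel : VertexDecomposableOn G (A.erase x))
      (hexch : ∀ S, IsIndepIn G (delClosedNbhd G A x) S →
        ∃ y ∈ A, G.Adj x y ∧ IsIndepIn G (A.erase x) (insert y S)) :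
      VertexDecomposableOn G A

/-- `x` is a shedding vertex of the induced subgraph of `G` on `A`. -/
def IsSheddingVertexOn (G : SimpleGraph V) (A : Finset V) (x : V) : Prop :=
  x ∈ A ∧
  VertexDecomposableOn G (delClosedNbhd G A x) ∧
  VertexDecomposableOn G (A.erase x) ∧
  ∀ S, IsIndepIn G (delClosedNbhd G A x) S →
    ∃ y ∈ A, G.Adj x y ∧ IsIndepIn G (A.erase x) (insert y S)

/-- The independence complex of the induced subgraph of `G` on `A` is shellable:
there is an ordering `F 0, F 1, …` of its facets (the maximal independent sets) such
that for every `i`, every face of the subcomplex `(⋃ j < i, ⟨F j⟩) ∩ ⟨F i⟩` is contained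
in a face of that subcomplex of cardinality `(F i).card - 1` (i.e. the subcomplex is
pure of dimension `dim (F i) - 1`). -/
def ShellableOn (G : SimpleGraph V) (A : Finset V) : Prop :=
  ∃ (t : ℕ) (F : Fin t → Finset V),
    Function.Injective F ∧
    (∀ S, IsMaxIndepIn G A S ↔ ∃ i, F i = S) ∧
    ∀ i : Fin t, ∀ S : Finset V, S ⊆ F i → (∃ j, j < i ∧ S ⊆ F j) →
      ∃ S' : Finset V, S ⊆ S' ∧ S' ⊆ F i ∧ (∃ j, j < i ∧ S' ⊆ F j) ∧
        S'.card = (F i).card - 1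

/-- A graph is chordal if every cycle of length at least four has a chord, i.e. an
edge of the graph joining two vertices of the cycle that is not an edge of the cycle. -/
def IsChordal (G : SimpleGraph V) : Prop :=
  ∀ (x : V) (w : G.Walk x x), w.IsCycle → 4 ≤ w.length →
    ∃ u v, u ∈ w.support ∧ v ∈ w.support ∧ G.Adj u v ∧ s(u, v) ∉ w.edges

/-- The induced subgraph of `G` on `A` is a cycle graph on `m` vertices. -/
def IsCycleGraphOn (G : SimpleGraph V) (A : Finset V) (m : ℕ) : Prop :=
  (∀ u v, G.Adj u v → u ∈ A ∧ v ∈ A) ∧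
  Nonempty (G.induce (A : Set V) ≃g SimpleGraph.cycleGraph m)

/-- The independence number of the induced subgraph of `G` on `A`. -/
noncomputable def indepNumOn (G : SimpleGraph V) (A : Finset V) : ℕ :=
  sSup {k | ∃ S, IsIndepIn G A S ∧ S.card = k}

/-- The graph obtained from the cycle `C₄` on the vertices `(i, 0)`, `i : Fin 4`, by
attaching at each vertex `(i, 0)` a path `(i, 0) - (i, 1) - (i, 2)` on three vertices. -/
def cycleWithPaths : SimpleGraph (Fin 4 × Fin 3) :=
  SimpleGraph.fromRel fun a b =>
    -- cycle edges
    (a.2 = 0 ∧ b.2 = 0 ∧ b.1 = a.1 + 1) ∨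
    -- path edges
    (a.1 = b.1 ∧ a.2 ≠ 2 ∧ b.2 = a.2 + 1)

theorem mem_delClosedNbhd_iff (G : SimpleGraph V) (A : Finset V) (x y : V) :
    y ∈ delClosedNbhd G A x ↔ y ∈ A ∧ y ≠ x ∧ ¬G.Adj x y := by
  simp [delClosedNbhd]

/-- Links of vertex decomposable graphs are vertex decomposable. -/
theorem VertexDecomposableOn.link {G : SimpleGraph V} {A : Finset V}
    (h : VertexDecomposableOn G A) :
    ∀ v ∈ A, VertexDecomposableOn G (delClosedNbhd G A v) := by
  induction h with
  | edgeless A h =>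
    intro v _
    refine .edgeless _ fun u hu w hw => h u ?_ w ?_
    · exact ((mem_delClosedNbhd_iff ..).1 hu).1
    · exact ((mem_delClosedNbhd_iff ..).1 hw).1
  | shed A x hx hlink hdel hexch ih1 ih2 =>
    intro v hv
    by_cases hvx : v = x
    · subst hvx; exact hlink
    have hv2 := ih2 v (Finset.mem_erase.2 ⟨hvx, hv⟩)
    by_cases hadj : G.Adj x v
    · have e : delClosedNbhd G A v = delClosedNbhd G (A.erase x) v := by
        ext y
        simp only [mem_delClosedNbhd_iff, Finset.mem_erase]
        constructor
        · rintro ⟨a, b, c⟩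
          refine ⟨⟨?_, a⟩, b, c⟩
          rintro rfl
          exact c hadj.symm
        · rintro ⟨⟨_, a⟩, b, c⟩
          exact ⟨a, b, c⟩
      rw [e]; exact hv2
    · have hvl : v ∈ delClosedNbhd G A x := (mem_delClosedNbhd_iff ..).2 ⟨hv, hvx, hadj⟩
      have hv1 := ih1 v hvl
      have e1 : delClosedNbhd G (delClosedNbhd G A v) x
          = delClosedNbhd G (delClosedNbhd G A x) v := by
        ext y; simp only [mem_delClosedNbhd_iff]; tauto
      have e2 : (delClosedNbhd G A v).erase x = delClosedNbhd G (A.erase x) v := by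
        ext y; simp only [mem_delClosedNbhd_iff, Finset.mem_erase]; tauto
      refine .shed _ x ?_ (e1 ▸ hv1) (e2 ▸ hv2) ?_
      · exact (mem_delClosedNbhd_iff ..).2 ⟨hx, Ne.symm hvx, fun h => hadj h.symm⟩
      · rintro S ⟨hS, hSi⟩
        have hS' : ∀ u ∈ S, ((u ∈ A ∧ u ≠ v ∧ ¬G.Adj v u) ∧ u ≠ x ∧ ¬G.Adj x u) := by
          intro u hu
          simpa only [mem_delClosedNbhd_iff] using hS hu
        obtain ⟨y, hyA, hxy, hsub, hind⟩ := hexch (insert v S) (by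
          constructor
          · intro u hu
            rcases Finset.mem_insert.1 hu with rfl | hu
            · exact hvl
            · exact (mem_delClosedNbhd_iff ..).2 ⟨(hS' u hu).1.1, (hS' u hu).2⟩
          · intro u hu w hw
            rcases Finset.mem_insert.1 hu with rfl | hu' <;>
              rcases Finset.mem_insert.1 hw with rfl | hw'
            · exact G.loopless.irrefl _
            · exact (hS' w hw').1.2.2
            · exact fun h => (hS' u hu').1.2.2 h.symm
            · exact hSi u hu' w hw')
        have hyv : y ≠ v := by rintro rfl; exact hadj hxy
        have hvy : ¬G.Adj v y := hind v (by simp) y (by simp)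
        have hy : y ∈ delClosedNbhd G A v := (mem_delClosedNbhd_iff ..).2 ⟨hyA, hyv, hvy⟩
        refine ⟨y, hy, hxy, ?_, ?_⟩
        · intro u hu
          rw [Finset.mem_erase]
          rcases Finset.mem_insert.1 hu with rfl | hu
          · exact ⟨hxy.ne', hy⟩
          · exact ⟨(hS' u hu).2.1, (mem_delClosedNbhd_iff ..).2 (hS' u hu).1⟩
        · intro u hu w hw
          apply hind
          · simp only [Finset.mem_insert] at hu ⊢; tauto
          · simp only [Finset.mem_insert] at hw ⊢; tauto

instance : DecidableRel cycleWithPaths.Adj := fun a b => by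
  unfold cycleWithPaths; simp only [SimpleGraph.fromRel_adj]; infer_instance

/-- The 4-cycle is not vertex decomposable. -/
theorem not_vd_cycle (A : Finset (Fin 4 × Fin 3)) (hA : ∀ p, p ∈ A ↔ p.2 = 0) :
    ¬ VertexDecomposableOn cycleWithPaths A := by
  intro h
  cases h with
  | edgeless _ h =>
    exact h (0, 0) ((hA _).2 rfl) (1, 0) ((hA _).2 rfl) (by decide)
  | shed _ x hx hlink hdel hexch =>
    have hx0 := (hA x).1 hx
    obtain ⟨i, j⟩ := x
    obtain rfl : j = 0 := hx0
    obtain ⟨y, hy, hxy, -, hind⟩ := hexch {(i + 2, 0)} (by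
      constructor
      · intro u hu
        obtain rfl := Finset.mem_singleton.1 hu
        refine (mem_delClosedNbhd_iff ..).2 ⟨(hA _).2 rfl, ?_⟩
        clear hx hlink hdel hexch hu
        revert i; decide
      · intro u hu w hw
        obtain rfl := Finset.mem_singleton.1 hu
        obtain rfl := Finset.mem_singleton.1 hw
        exact cycleWithPaths.loopless.irrefl _)
    have h1 := hind (i + 2, 0) (by simp) y (by simp)
    have hy0 := (hA y).1 hy
    obtain ⟨k, l⟩ := y
    obtain rfl : l = 0 := hy0
    clear hind hy hx hlink hdel hexch hA
    revert i k; decide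

/-- the graph obtained from `C₄` by attaching a path on three vertices at
each vertex is not vertex decomposable. -/
theorem stmt_18 : ¬ VertexDecomposableOn cycleWithPaths Finset.univ := by
  intro h
  have h0 := h.link (0, 2) (by simp)
  have h1 := h0.link (1, 2) (by simp only [mem_delClosedNbhd_iff, Finset.mem_univ]; decide)
  have h2 := h1.link (2, 2) (by simp only [mem_delClosedNbhd_iff, Finset.mem_univ]; decide)
  have h3 := h2.link (3, 2) (by simp only [mem_delClosedNbhd_iff, Finset.mem_univ]; decide)
  refine not_vd_cycle _ ?_ h3
  simp only [mem_delClosedNbhd_iff, Finset.mem_univ]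
  decide
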